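/- For any real numbers s, t ∈ [−2,2] and any real number u ∈ I_{s,t}, there exist matrices A, B ∈ SU(2) with tr A = s, tr B = t and tr(AB) = u. -/

import Mathlib

open Matrix

/-- The interval `I_{s,t} = [(st − √((4−s²)(4−t²)))/2, (st + √((4−s²)(4−t²)))/2]`. -/
def Ist (s t : ℝ) : Set ℝ :=
  Set.Icc ((s * t - Real.sqrt ((4 - s ^ 2) * (4 - t ^ 2))) / 2)
          ((s * t + Real.sqrt ((4 - s ^ 2) * (4 - t ^ 2))) / 2)

/-- If `|c| ≤ a * r` with `a ≥ 0`, then `c` is a multiple `a * b` with `b ^ 2 ≤ r ^ 2`. -/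
lemma exists_mul_eq_of_abs_le {a r c : ℝ} (ha : 0 ≤ a) (hc : |c| ≤ a * r) :
    ∃ b : ℝ, a * b = c ∧ b ^ 2 ≤ r ^ 2 := by
  rcases ha.eq_or_lt with rfl | ha
  · have : c = 0 := by simpa using hc
    exact ⟨0, by simp [this], by simpa using sq_nonneg r⟩
  · refine ⟨c / a, by field_simp, sq_le_sq.mpr ?_⟩
    rw [abs_div, abs_of_pos ha]
    exact ((div_le_iff₀' ha).mpr hc).trans (le_abs_self r)

/-- The matrix of the quaternion with complex diagonal entry `x + i y` and real
off-diagonal entry `w`. -/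
def su2Matrix (x y w : ℝ) : Matrix (Fin 2) (Fin 2) ℂ :=
  !![⟨x, y⟩, -w; w, ⟨x, -y⟩]

lemma su2Matrix_mem_unitaryGroup {x y w : ℝ} (h : x ^ 2 + y ^ 2 + w ^ 2 = 1) :
    su2Matrix x y w ∈ Matrix.unitaryGroup (Fin 2) ℂ := by
  rw [Matrix.mem_unitaryGroup_iff]
  ext i j
  fin_cases i <;> fin_cases j <;>
    simp [su2Matrix, Matrix.mul_apply, Fin.sum_univ_two, Complex.ext_iff] <;>
    constructor <;> linarith

lemma det_su2Matrix {x y w : ℝ} (h : x ^ 2 + y ^ 2 + w ^ 2 = 1) :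
    (su2Matrix x y w).det = 1 := by
  rw [su2Matrix, Matrix.det_fin_two_of]
  apply Complex.ext
  · simp
    linarith
  · simp
    ring

lemma trace_su2Matrix (x y w : ℝ) : (su2Matrix x y w).trace = ((2 * x : ℝ) : ℂ) := by
  apply Complex.ext <;> simp [su2Matrix, Matrix.trace_fin_two, two_mul]

lemma trace_su2Matrix_mul (x y w x' y' w' : ℝ) :
    (su2Matrix x y w * su2Matrix x' y' w').trace =
      ((2 * (x * x' - y * y' - w * w') : ℝ) : ℂ) := by
  apply Complex.ext <;>
    simp [su2Matrix, Matrix.trace_fin_two] <;> ring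

/-- Every triple `(s, t, u)` with `s, t ∈ [-2,2]` and `u ∈ I_{s,t}` is realized
as `(tr A, tr B, tr(AB))` for some `A, B ∈ SU(2)`. -/
theorem exists_su2_with_traces (s t u : ℝ)
    (hs : s ∈ Set.Icc (-2 : ℝ) 2) (ht : t ∈ Set.Icc (-2 : ℝ) 2)
    (hu : u ∈ Ist s t) :
    ∃ A B : Matrix (Fin 2) (Fin 2) ℂ,
      A ∈ Matrix.unitaryGroup (Fin 2) ℂ ∧ A.det = 1 ∧
      B ∈ Matrix.unitaryGroup (Fin 2) ℂ ∧ B.det = 1 ∧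
      A.trace = (s : ℂ) ∧ B.trace = (t : ℂ) ∧ (A * B).trace = (u : ℂ) := by
  have hs4 : 0 ≤ 4 - s ^ 2 := by nlinarith [hs.1, hs.2]
  have ht4 : 0 ≤ 4 - t ^ 2 := by nlinarith [ht.1, ht.2]
  have ha := Real.sq_sqrt hs4
  have hr := Real.sq_sqrt ht4
  obtain ⟨hu₁, hu₂⟩ := hu
  rw [Real.sqrt_mul hs4] at hu₁ hu₂
  obtain ⟨b, hb, hbr⟩ := exists_mul_eq_of_abs_le (r := √(4 - t ^ 2)) (c := s * t - 2 * u)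
    (Real.sqrt_nonneg (4 - s ^ 2)) (abs_le.mpr ⟨by linarith, by linarith⟩)
  have hw := Real.sq_sqrt (show 0 ≤ 4 - t ^ 2 - b ^ 2 by linarith)
  set a := √(4 - s ^ 2)
  set w := √(4 - t ^ 2 - b ^ 2)
  have hA : (s / 2) ^ 2 + (a / 2) ^ 2 + 0 ^ 2 = 1 := by linarith
  have hB : (t / 2) ^ 2 + (b / 2) ^ 2 + (w / 2) ^ 2 = 1 := by linarith
  refine ⟨su2Matrix (s / 2) (a / 2) 0, su2Matrix (t / 2) (b / 2) (w / 2),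
    su2Matrix_mem_unitaryGroup hA, det_su2Matrix hA,
    su2Matrix_mem_unitaryGroup hB, det_su2Matrix hB, ?_, ?_, ?_⟩
  · rw [trace_su2Matrix, mul_div_cancel₀ s two_ne_zero]
  · rw [trace_su2Matrix, mul_div_cancel₀ t two_ne_zero]
  · rw [trace_su2Matrix_mul]
    congr 1
    linarith
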